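/- Let ν > 0, t > 0, b ∈ ℝ, K₀ > 0, and set x_k^t = k/t + b. Then Σ_{k : |x_k^t| ≥ K₀} e^{-ν t (x_k^t)^2} ≤ (2 + 2√t/√ν) e^{-ν t K₀^2}. -/

import Mathlib

open MeasureTheory in
theorem sum_range_exp_neg_mul_sq_le {a : ℝ} (ha : 0 < a) (n : ℕ) :
    ∑ i ∈ Finset.range n, Real.exp (-a * (i : ℝ) ^ 2) ≤ 1 + Real.sqrt (Real.pi / a) / 2 := by
  cases n with
  | zero => simp; positivity
  | succ n =>
    have hanti : AntitoneOn (fun x : ℝ => Real.exp (-a * x ^ 2))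
        (Set.Icc (0 : ℝ) (0 + (n : ℝ))) := by
      intro x hx y _ hxy
      have : x ^ 2 ≤ y ^ 2 := pow_le_pow_left₀ hx.1 hxy 2
      exact Real.exp_le_exp.2 (by nlinarith)
    have hsum := hanti.sum_le_integral
    have hint : ∫ x in (0 : ℝ)..(0 + (n : ℝ)), Real.exp (-a * x ^ 2) ≤
        Real.sqrt (Real.pi / a) / 2 := by
      rw [← integral_gaussian_Ioi, intervalIntegral.integral_of_le (by simp)]
      exact setIntegral_mono_set (integrable_exp_neg_mul_sq ha).integrableOn
        (Filter.Eventually.of_forall fun x => (Real.exp_pos _).le)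
        Set.Ioc_subset_Ioi_self.eventuallyLE
    rw [Finset.sum_range_succ']
    simp only [zero_add] at hsum hint
    simp only [Nat.cast_zero, ne_eq, OfNat.ofNat_ne_zero, not_false_eq_true, zero_pow, mul_zero,
      Real.exp_zero]
    linarith

theorem exp_neg_mul_sq_le_of_add_div_le {ν t K y n : ℝ} (hν : 0 < ν) (ht : 0 < t) (hK : 0 < K)
    (hn : 0 ≤ n) (hy : K + n / t ≤ |y|) :
    Real.exp (-ν * t * y ^ 2) ≤
      Real.exp (-ν * t * K ^ 2) * Real.exp (-(ν / t) * n ^ 2) := by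
  rw [← Real.exp_add, Real.exp_le_exp]
  have hnt : 0 ≤ n / t := by positivity
  have hsq : K ^ 2 + (n / t) ^ 2 ≤ y ^ 2 := by
    rw [← sq_abs y]
    nlinarith [mul_nonneg hK.le hnt]
  have hn' : ν / t * n ^ 2 = ν * t * (n / t) ^ 2 := by field_simp
  nlinarith [mul_le_mul_of_nonneg_left hsq (mul_pos hν ht).le]

theorem exists_injective_add_div_le_abs {t b K : ℝ} (ht : 0 < t) :
    ∃ g : {k : ℤ // K ≤ |(k : ℝ) / t + b|} → ℕ ⊕ ℕ, Function.Injective g ∧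
      ∀ k, K + ((g k).elim id id : ℕ) / t ≤ |(k.1 : ℝ) / t + b| := by
  set m : ℤ := ⌈t * (K - b)⌉
  set m' : ℤ := ⌊t * (-K - b)⌋
  have key (k : {k : ℤ // K ≤ |(k : ℝ) / t + b|}) (hk : ¬ m ≤ k.1) : k.1 ≤ m' := by
    have h : ¬ K ≤ (k.1 : ℝ) / t + b := by
      intro h
      refine hk (Int.ceil_le.2 ?_)
      rw [← le_div_iff₀' ht]
      linarith
    have h' : K ≤ -((k.1 : ℝ) / t + b) := (le_abs.1 k.2).resolve_left h
    refine Int.le_floor.2 ?_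
    rw [← div_le_iff₀' ht]
    linarith
  refine ⟨fun k => if m ≤ k.1 then .inl (k.1 - m).toNat else .inr (m' - k.1).toNat, ?_, ?_⟩
  · intro k l hkl
    have h₁ := key k
    have h₂ := key l
    apply Subtype.ext
    dsimp only at hkl
    split_ifs at hkl <;> simp only [Sum.inl.injEq, Sum.inr.injEq] at hkl <;> grind
  · intro k
    dsimp only
    split_ifs with h
    · have hc : (((k.1 - m).toNat : ℕ) : ℝ) = k.1 - m := by
        exact_mod_cast Int.toNat_of_nonneg (sub_nonneg.2 h)
      have hceil : K - b ≤ m / t := by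
        rw [le_div_iff₀' ht]
        exact Int.le_ceil _
      simp only [Sum.elim_inl, id, hc, sub_div]
      exact le_trans (by linarith) (le_abs_self _)
    · have hc : (((m' - k.1).toNat : ℕ) : ℝ) = m' - k.1 := by
        exact_mod_cast Int.toNat_of_nonneg (sub_nonneg.2 (key k h))
      have hfloor : m' / t ≤ -K - b := by
        rw [div_le_iff₀' ht]
        exact Int.floor_le _
      simp only [Sum.elim_inr, id, hc, sub_div]
      exact le_trans (by linarith) (neg_le_abs _)

/-- Gaussian tail bound for lattice sums: with `x_k^t = k/t + b`,
`∑_{|x_k^t| ≥ K₀} e^{-ν t (x_k^t)²} ≤ (2 + 2√t/√ν) e^{-ν t K₀²}`. -/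
theorem stmt5 (ν t b K₀ : ℝ) (hν : 0 < ν) (ht : 0 < t) (hK : 0 < K₀) :
    Summable (fun k : {k : ℤ // K₀ ≤ |(k : ℝ) / t + b|} =>
      Real.exp (-ν * t * ((k.1 : ℝ) / t + b) ^ 2)) ∧
    ∑' k : {k : ℤ // K₀ ≤ |(k : ℝ) / t + b|},
        Real.exp (-ν * t * ((k.1 : ℝ) / t + b) ^ 2) ≤
      (2 + 2 * Real.sqrt t / Real.sqrt ν) * Real.exp (-ν * t * K₀ ^ 2) := by
  obtain ⟨g, hg, hgle⟩ := exists_injective_add_div_le_abs (b := b) (K := K₀) ht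
  have ha : 0 < ν / t := div_pos hν ht
  set C := Real.exp (-ν * t * K₀ ^ 2)
  let q : ℕ → ℝ := fun n => Real.exp (-(ν / t) * (n : ℝ) ^ 2)
  let h : ℕ ⊕ ℕ → ℝ := fun s => C * q (s.elim id id)
  have hq : Summable q :=
    summable_of_sum_range_le (fun _ => (Real.exp_pos _).le) (sum_range_exp_neg_mul_sq_le ha)
  have hqle : ∑' n, q n ≤ 1 + Real.sqrt t / Real.sqrt ν := by
    refine (Real.tsum_le_of_sum_range_le (fun _ => (Real.exp_pos _).le)
      (sum_range_exp_neg_mul_sq_le ha)).trans ?_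
    have hpi : Real.sqrt Real.pi ≤ 2 :=
      Real.sqrt_le_iff.2 ⟨by norm_num, by linarith [Real.pi_le_four]⟩
    have hs : Real.sqrt (Real.pi / (ν / t)) =
        Real.sqrt Real.pi * (Real.sqrt t / Real.sqrt ν) := by
      rw [← Real.sqrt_div ht.le, ← Real.sqrt_mul Real.pi_pos.le]
      congr 1
      field_simp
    have : 0 ≤ Real.sqrt t / Real.sqrt ν := by positivity
    rw [hs]
    nlinarith
  have hh : HasSum h (C * ∑' n, q n + C * ∑' n, q n) :=
    HasSum.sum (hq.hasSum.mul_left C) (hq.hasSum.mul_left C)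
  have hle (k : {k : ℤ // K₀ ≤ |(k : ℝ) / t + b|}) :
      Real.exp (-ν * t * ((k.1 : ℝ) / t + b) ^ 2) ≤ h (g k) :=
    exp_neg_mul_sq_le_of_add_div_le hν ht hK (Nat.cast_nonneg _) (hgle k)
  have hsum : Summable (fun k : {k : ℤ // K₀ ≤ |(k : ℝ) / t + b|} =>
      Real.exp (-ν * t * ((k.1 : ℝ) / t + b) ^ 2)) :=
    .of_nonneg_of_le (fun _ => (Real.exp_pos _).le) hle (hh.summable.comp_injective hg)
  refine ⟨hsum, ?_⟩
  calc _ ≤ ∑' s, h s := hsum.tsum_le_tsum_of_inj g hg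
        (fun _ _ => mul_nonneg (Real.exp_pos _).le (Real.exp_pos _).le) hle hh.summable
    _ = 2 * (∑' n, q n) * C := by rw [hh.tsum_eq]; ring
    _ ≤ (2 + 2 * Real.sqrt t / Real.sqrt ν) * C := by
      refine mul_le_mul_of_nonneg_right ?_ (Real.exp_pos _).le
      rw [mul_div_assoc]
      linarith
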